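/- arXiv:1011.5994 — 2 statements merged into one kernel-verified Lean document; each statement's English description precedes it below -/
import Mathlib

section
/- Consider a random graph G(n,(d_i)_1^n) where the degree sequence (d_i)_1^n satisfies Condition 1. Then G(n,(d_i)_1^n) is connected with probability tending to 1 as n → ∞. -/
open MeasureTheory ProbabilityTheory Filter

noncomputable section

attribute [local instance] Classical.propDecidable

namespace Flooding

instance {V : Type*} : MeasurableSpace (SimpleGraph V) := ⊤

/-- Weighted distance in a graph with edge weights `w`. -/
def distW {V : Type*} (G : SimpleGraph V) (w : Sym2 V → ℝ) (a b : V) : ℝ :=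
  sInf {x | ∃ p : G.Walk a b, x = (p.edges.map w).sum}

/-- Weighted diameter. -/
def diamW {V : Type*} (G : SimpleGraph V) (w : Sym2 V → ℝ) : ℝ :=
  sSup {x | ∃ a b : V, x = distW G w a b}

/-- Weighted flooding time from `a`. -/
def floodW {V : Type*} (G : SimpleGraph V) (w : Sym2 V → ℝ) (a : V) : ℝ :=
  sSup {x | ∃ b : V, x = distW G w a b}

/-- ball of radius t -/
def ballW {V : Type*} (G : SimpleGraph V) (w : Sym2 V → ℝ) (a : V) (t : ℝ) : Set V :=
  {b | distW G w a b ≤ t}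

/-- T_a(k), with a real threshold `k`. -/
def hitTime {V : Type*} (G : SimpleGraph V) (w : Sym2 V → ℝ) (a : V) (k : ℝ) : ℝ :=
  sInf {t | 0 ≤ t ∧ k ≤ ((ballW G w a t).ncard : ℝ)}

/-- Condition 1 of the paper. -/
structure DegreeCondition (d : ∀ n : ℕ, Fin n → ℕ) (p : ℕ → ℝ) (dmin : ℕ) : Prop where
  even_sum : ∀ n, Even (∑ i, d n i)
  nonneg : ∀ r, 0 ≤ p r
  sum_one : ∑' r, p r = 1
  tendsto_freq : ∀ r : ℕ, Tendsto
    (fun n => ((Finset.univ.filter fun i : Fin n => d n i = r).card : ℝ) / n) atTop (nhds (p r))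
  summable_mul : Summable (fun r : ℕ => (r : ℝ) * p r)
  lambda_pos : 0 < ∑' r : ℕ, (r : ℝ) * p r
  sq_bound : ∃ C : ℝ, ∀ n, (∑ i, (d n i : ℝ) ^ 2) ≤ C * n
  max_bound : ∃ τ : ℝ, 0 < τ ∧ ∃ C : ℝ, ∀ n,
    ((Finset.univ.sup (d n) : ℕ) : ℝ) ≤ C * (n : ℝ) ^ ((1 : ℝ) / 2 - τ)
  min_eq : ∀ n, 0 < n → sInf (Set.range (d n)) = dmin
  min_ge : 3 ≤ dmin
  p_dmin_pos : 0 < p dmin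

/-- λ -/
def lambdaOf (p : ℕ → ℝ) : ℝ := ∑' r : ℕ, (r : ℝ) * p r

/-- ν, the mean of the size-biased distribution q. -/
def nuOf (p : ℕ → ℝ) : ℝ := (∑' r : ℕ, (r : ℝ) * (((r : ℝ) + 1) * p (r + 1))) / lambdaOf p

/-- uniform random simple graph with degree sequence `dseq`. -/
def uniformGraph (n : ℕ) (dseq : Fin n → ℕ) : Measure (SimpleGraph (Fin n)) :=
  uniformOn {G | ∀ i, G.degree i = dseq i}

/-- i.i.d. weights on potential edges, exponential with rate `r`. -/
def weightMeasure (n : ℕ) (r : ℝ) : Measure (Sym2 (Fin n) → ℝ) :=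
  Measure.pi fun _ => expMeasure r

/-- α_n = log³ n -/
def alphaSeq (n : ℕ) : ℝ := (Real.log n) ^ 3

/-- β_n = 3 √(λ n log n/(ν−1)) -/
def betaSeq (p : ℕ → ℝ) (n : ℕ) : ℝ :=
  3 * Real.sqrt (lambdaOf p / (nuOf p - 1) * n * Real.log n)

end Flooding

namespace Flooding

section AdjSum

variable {V : Type*} [Fintype V]

/-- The sum of `f p q` over the ordered adjacent pairs `(p, q)` of `G`. -/
def adjSum (G : SimpleGraph V) (f : V → V → ℤ) : ℤ :=
  ∑ p, ∑ q, if G.Adj p q then f p q else 0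

lemma adjSum_sup {G H : SimpleGraph V} (h : Disjoint G H) (f : V → V → ℤ) :
    adjSum (G ⊔ H) f = adjSum G f + adjSum H f := by
  simp only [adjSum, ← Finset.sum_add_distrib]
  refine Finset.sum_congr rfl fun p _ => Finset.sum_congr rfl fun q _ => ?_
  have hpq : ¬ (G.Adj p q ∧ H.Adj p q) := fun hh => by
    have := h.le_bot (show (G ⊓ H).Adj p q from hh)
    simp at this
  by_cases h1 : G.Adj p q <;> by_cases h2 : H.Adj p q <;> simp_all

lemma adjSum_sdiff {G H : SimpleGraph V} (h : H ≤ G) (f : V → V → ℤ) :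
    adjSum (G \ H) f = adjSum G f - adjSum H f := by
  have := adjSum_sup (G := G \ H) (H := H) disjoint_sdiff_self_left f
  rw [sdiff_sup_cancel h] at this
  lia

lemma adjSum_edge {a b : V} (h : a ≠ b) (f : V → V → ℤ) :
    adjSum (SimpleGraph.edge a b) f = f a b + f b a := by
  have key : ∀ p q (_ : Decidable ((SimpleGraph.edge a b).Adj p q)),
      (if (SimpleGraph.edge a b).Adj p q then f p q else 0) =
      (if p = a then if q = b then f p q else 0 else 0) +
        (if p = b then if q = a then f p q else 0 else 0) := by
    intro p q _
    simp only [SimpleGraph.edge_adj]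
    split_ifs <;> simp_all
  simp only [adjSum, key, Finset.sum_add_distrib]
  simp

lemma adjSum_eq_card (G : SimpleGraph V) (P : V → V → Prop) :
    adjSum G (fun p q => if P p q then 1 else 0) =
      ((Finset.univ.filter fun e : V × V => G.Adj e.1 e.2 ∧ P e.1 e.2).card : ℤ) := by
  rw [Finset.card_filter, Fintype.sum_prod_type]
  push_cast
  simp only [adjSum, ite_and]

lemma degree_eq_adjSum (G : SimpleGraph V) (v : V) :
    (G.degree v : ℤ) = adjSum G (fun p _ => if p = v then 1 else 0) := by
  rw [adjSum, Finset.sum_eq_single v]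
  · rw [← G.card_neighborFinset_eq_degree, G.neighborFinset_eq_filter, Finset.card_filter]
    push_cast
    simp
  · intro p _ hp
    simp [hp]
  · simp

lemma adjSum_swap (G : SimpleGraph V) (f : V → V → ℤ) :
    adjSum G f = adjSum G (fun p q => f q p) := by
  rw [adjSum, Finset.sum_comm]
  simp only [adjSum, G.adj_comm]

/-- The ordered pairs of adjacent vertices leaving `A`. -/
def cut (G : SimpleGraph V) (A : Finset V) : Finset (V × V) :=
  Finset.univ.filter fun e => G.Adj e.1 e.2 ∧ e.1 ∈ A ∧ e.2 ∉ A

/-- The ordered pairs of adjacent vertices inside `A`. -/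
def inside (G : SimpleGraph V) (A : Finset V) : Finset (V × V) :=
  Finset.univ.filter fun e => G.Adj e.1 e.2 ∧ e.1 ∈ A ∧ e.2 ∈ A

lemma card_cut (G : SimpleGraph V) (A : Finset V) :
    ((cut G A).card : ℤ) = adjSum G (fun p q => if p ∈ A ∧ q ∉ A then 1 else 0) := by
  rw [cut]
  convert (adjSum_eq_card G fun p q => p ∈ A ∧ q ∉ A).symm

lemma card_inside (G : SimpleGraph V) (A : Finset V) :
    ((inside G A).card : ℤ) = adjSum G (fun p q => if p ∈ A ∧ q ∈ A then 1 else 0) := by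
  rw [inside]
  convert (adjSum_eq_card G fun p q => p ∈ A ∧ q ∈ A).symm

lemma card_cut_compl (G : SimpleGraph V) (A : Finset V) :
    (cut G Aᶜ).card = (cut G A).card := by
  have h := card_cut G Aᶜ
  rw [adjSum_swap] at h
  have h' := card_cut G A
  simp only [Finset.mem_compl, not_not, and_comm] at h h'
  rw [← h'] at h
  exact_mod_cast h

lemma card_inside_add_card_cut (G : SimpleGraph V) (A : Finset V) :
    (inside G A).card + (cut G A).card = ∑ v ∈ A, G.degree v := by
  zify
  rw [card_inside, card_cut, adjSum, adjSum, ← Finset.sum_add_distrib]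
  rw [← Finset.sum_subset (Finset.subset_univ A)]
  · refine Finset.sum_congr rfl fun v hv => ?_
    rw [← G.card_neighborFinset_eq_degree, G.neighborFinset_eq_filter, Finset.card_filter,
      ← Finset.sum_add_distrib]
    push_cast
    refine Finset.sum_congr rfl fun q _ => ?_
    by_cases hq : q ∈ A <;> simp [hv, hq]
  · intro v _ hv
    simp [hv]

end AdjSum

section Switching

variable {V : Type*}

/-- A switch at `(x₁, x₂, y₁, y₂)` replaces the edges `x₁x₂`, `y₁y₂` by `x₁y₁`, `x₂y₂`. -/
def switch (G : SimpleGraph V) (x₁ x₂ y₁ y₂ : V) : SimpleGraph V :=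
  (G \ (SimpleGraph.edge x₁ x₂ ⊔ SimpleGraph.edge y₁ y₂)) ⊔
    (SimpleGraph.edge x₁ y₁ ⊔ SimpleGraph.edge x₂ y₂)

/-- `(x₁, x₂, y₁, y₂)` is a place where `G` can be switched to create two edges leaving `A`. -/
structure Switchable (G : SimpleGraph V) (A : Finset V) (x₁ x₂ y₁ y₂ : V) : Prop where
  adj_x : G.Adj x₁ x₂
  x₁_mem : x₁ ∈ A
  x₂_mem : x₂ ∈ A
  adj_y : G.Adj y₁ y₂
  y₁_notMem : y₁ ∉ A
  y₂_notMem : y₂ ∉ A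
  not_adj₁ : ¬ G.Adj x₁ y₁
  not_adj₂ : ¬ G.Adj x₂ y₂

namespace Switchable

variable {G : SimpleGraph V} {A : Finset V} {x₁ x₂ y₁ y₂ : V}

lemma removed_le (h : Switchable G A x₁ x₂ y₁ y₂) :
    SimpleGraph.edge x₁ x₂ ⊔ SimpleGraph.edge y₁ y₂ ≤ G :=
  sup_le ((SimpleGraph.edge_le_iff _).2 (.inr h.adj_x))
    ((SimpleGraph.edge_le_iff _).2 (.inr h.adj_y))

lemma disjoint_added (h : Switchable G A x₁ x₂ y₁ y₂) :
    Disjoint G (SimpleGraph.edge x₁ y₁ ⊔ SimpleGraph.edge x₂ y₂) :=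
  ((SimpleGraph.disjoint_edge _).2 h.not_adj₁).sup_right
    ((SimpleGraph.disjoint_edge _).2 h.not_adj₂)

lemma switch_undo (h : Switchable G A x₁ x₂ y₁ y₂) :
    (switch G x₁ x₂ y₁ y₂ \ (SimpleGraph.edge x₁ y₁ ⊔ SimpleGraph.edge x₂ y₂)) ⊔
      (SimpleGraph.edge x₁ x₂ ⊔ SimpleGraph.edge y₁ y₂) = G := by
  rw [switch, (h.disjoint_added.mono_left sdiff_le).sup_sdiff_cancel_right,
    sdiff_sup_cancel h.removed_le]

variable [Fintype V]

lemma adjSum_switch (h : Switchable G A x₁ x₂ y₁ y₂) (f : V → V → ℤ) :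
    adjSum (switch G x₁ x₂ y₁ y₂) f = adjSum G f - (f x₁ x₂ + f x₂ x₁ + (f y₁ y₂ + f y₂ y₁)) +
      (f x₁ y₁ + f y₁ x₁ + (f x₂ y₂ + f y₂ x₂)) := by
  have ⟨hx, hx1, hx2, hy, hy1, hy2, _, _⟩ := h
  have ne : ∀ {a b}, a ∈ A → b ∉ A → a ≠ b := fun ha hb hab => hb (hab ▸ ha)
  rw [switch, adjSum_sup (h.disjoint_added.mono_left sdiff_le), adjSum_sdiff h.removed_le,
    adjSum_sup, adjSum_sup, adjSum_edge hx.ne, adjSum_edge hy.ne, adjSum_edge (ne hx1 hy1),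
    adjSum_edge (ne hx2 hy2)]
  · refine (SimpleGraph.disjoint_edge _).2 ?_
    have := hx.ne
    rw [SimpleGraph.edge_adj]
    rintro ⟨⟨rfl, -⟩ | ⟨rfl, -⟩, -⟩ <;> contradiction
  · refine (SimpleGraph.disjoint_edge _).2 ?_
    rw [SimpleGraph.edge_adj]
    rintro ⟨⟨rfl, -⟩ | ⟨rfl, -⟩, -⟩ <;> contradiction

lemma degree_switch (h : Switchable G A x₁ x₂ y₁ y₂) (v : V) :
    (switch G x₁ x₂ y₁ y₂).degree v = G.degree v := by
  zify
  rw [degree_eq_adjSum, degree_eq_adjSum, h.adjSum_switch]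
  ring

lemma card_cut_switch (h : Switchable G A x₁ x₂ y₁ y₂) :
    (cut (switch G x₁ x₂ y₁ y₂) A).card = (cut G A).card + 2 := by
  zify
  rw [card_cut, card_cut, h.adjSum_switch]
  simp [h.x₁_mem, h.x₂_mem, h.y₁_notMem, h.y₂_notMem]

lemma mem_offDiag_cut_switch (h : Switchable G A x₁ x₂ y₁ y₂) :
    ((x₁, y₁), (x₂, y₂)) ∈ (cut (switch G x₁ x₂ y₁ y₂) A).offDiag := by
  have ne : ∀ {a b}, a ∈ A → b ∉ A → a ≠ b := fun ha hb hab => hb (hab ▸ ha)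
  have hx := h.adj_x.ne
  simp [cut, switch, SimpleGraph.edge_adj, h.x₁_mem, h.x₂_mem, h.y₁_notMem, h.y₂_notMem, hx,
    ne h.x₁_mem h.y₁_notMem, ne h.x₂_mem h.y₂_notMem]

end Switchable

variable [Fintype V]

/-- The places where `G` can be switched across `A`. -/
def switches (G : SimpleGraph V) (A : Finset V) : Finset ((V × V) × V × V) :=
  Finset.univ.filter fun z => Switchable G A z.1.1 z.1.2 z.2.1 z.2.2

lemma card_filter_blocked_le (G : SimpleGraph V) (A : Finset V) {Δ : ℕ}
    (hΔ : ∀ v, G.degree v ≤ Δ) :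
    ((Finset.univ : Finset ((V × V) × V × V)).filter fun z =>
      G.Adj z.1.1 z.1.2 ∧ G.Adj z.2.1 z.2.2 ∧ (z.1.1, z.2.1) ∈ cut G A).card ≤
      (cut G A).card * Δ ^ 2 := by
  have hinj : Set.InjOn (fun z : (V × V) × V × V => (⟨(z.1.1, z.2.1), (z.1.2, z.2.2)⟩ :
      Σ _ : V × V, V × V)) (((Finset.univ : Finset ((V × V) × V × V)).filter fun z =>
      G.Adj z.1.1 z.1.2 ∧ G.Adj z.2.1 z.2.2 ∧ (z.1.1, z.2.1) ∈ cut G A) : Set _) := by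
    rintro ⟨⟨a, b⟩, c, e⟩ - ⟨⟨a', b'⟩, c', e'⟩ - hh
    simp at hh
    simp [hh]
  refine (Finset.card_le_card_of_injOn (t := (cut G A).sigma fun e =>
    G.neighborFinset e.1 ×ˢ G.neighborFinset e.2) _ ?_ hinj).trans ?_
  · intro z hz
    simpa [and_comm, and_assoc, and_left_comm] using hz
  · rw [Finset.card_sigma, ← smul_eq_mul]
    refine Finset.sum_le_card_nsmul _ _ _ fun e _ => ?_
    rw [Finset.card_product, sq]
    exact Nat.mul_le_mul (hΔ _) (hΔ _)

lemma card_switches (G : SimpleGraph V) (A : Finset V) {Δ : ℕ} (hΔ : ∀ v, G.degree v ≤ Δ) :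
    (inside G A).card * (inside G Aᶜ).card ≤
      (switches G A).card + 2 * ((cut G A).card * Δ ^ 2) := by
  set B := (Finset.univ : Finset ((V × V) × V × V)).filter fun z =>
      G.Adj z.1.1 z.1.2 ∧ G.Adj z.2.1 z.2.2 ∧ (z.1.1, z.2.1) ∈ cut G A
  set B' := (Finset.univ : Finset ((V × V) × V × V)).filter fun z =>
      G.Adj z.1.1 z.1.2 ∧ G.Adj z.2.1 z.2.2 ∧ (z.1.2, z.2.2) ∈ cut G A
  have hBc : B.card ≤ (cut G A).card * Δ ^ 2 := card_filter_blocked_le G A hΔ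
  have hBB : B'.card ≤ B.card := by
    refine Finset.card_le_card_of_injOn (fun z => (z.1.swap, z.2.swap)) ?_ ?_
    · intro z hz
      simp only [B, B', Finset.coe_filter, Finset.mem_univ, true_and, Set.mem_ofPred_eq] at hz ⊢
      exact ⟨hz.1.symm, hz.2.1.symm, hz.2.2⟩
    · rintro ⟨⟨a, b⟩, c, e⟩ - ⟨⟨a', b'⟩, c', e'⟩ - hh
      simp at hh
      simp [hh]
  have hsub : inside G A ×ˢ inside G Aᶜ ⊆ switches G A ∪ (B ∪ B') := by
    rintro ⟨⟨a, b⟩, c, e⟩ hz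
    simp only [inside, Finset.mem_product, Finset.mem_filter, Finset.mem_univ, true_and,
      Finset.mem_compl] at hz
    obtain ⟨⟨hab, ha, hb⟩, hce, hc, he⟩ := hz
    by_cases h1 : G.Adj a c
    · simp [B, cut, *]
    by_cases h2 : G.Adj b e
    · simp [B', cut, *]
    · refine Finset.mem_union_left _ ?_
      simp only [switches, Finset.mem_filter, Finset.mem_univ, true_and]
      exact ⟨hab, ha, hb, hce, hc, he, h1, h2⟩
  have h := (Finset.card_le_card hsub).trans (Finset.card_union_le _ _)
  have h' := Finset.card_union_le B B'
  rw [Finset.card_product] at h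
  lia

/-- The graphs with degree sequence `d` that have exactly `c` edges leaving `A`. -/
def graphsWithCut (d : V → ℕ) (A : Finset V) (c : ℕ) : Finset (SimpleGraph V) :=
  Finset.univ.filter fun G => (∀ v, G.degree v = d v) ∧ (cut G A).card = c

lemma sum_card_switches_le (d : V → ℕ) (A : Finset V) (c : ℕ) :
    ∑ G ∈ graphsWithCut d A c, (switches G A).card ≤
      (graphsWithCut d A (c + 2)).card * ((c + 2) * (c + 1)) := by
  have hcard : ((graphsWithCut d A (c + 2)).sigma fun G => (cut G A).offDiag).card =
      (graphsWithCut d A (c + 2)).card * ((c + 2) * (c + 1)) := by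
    rw [Finset.card_sigma, ← smul_eq_mul]
    refine Finset.sum_const_nat ?_
    intro G hG
    simp only [graphsWithCut, Finset.mem_filter] at hG
    rw [Finset.offDiag_card, hG.2.2, ← Nat.mul_sub_one]
    rfl
  rw [← hcard, ← Finset.card_sigma]
  refine Finset.card_le_card_of_injOn (fun w => ⟨switch w.1 w.2.1.1 w.2.1.2 w.2.2.1 w.2.2.2,
    ((w.2.1.1, w.2.2.1), (w.2.1.2, w.2.2.2))⟩) ?_ ?_
  · rintro ⟨G, ⟨a, b⟩, c, e⟩ hw
    simp only [Finset.coe_sigma, Set.mem_sigma_iff, Finset.mem_coe, graphsWithCut, switches,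
      Finset.mem_filter, Finset.mem_univ, true_and] at hw ⊢
    obtain ⟨⟨hd, hc⟩, hs⟩ := hw
    exact ⟨⟨fun v => (hs.degree_switch v).trans (hd v), hs.card_cut_switch.trans (by rw [hc])⟩,
      hs.mem_offDiag_cut_switch⟩
  · rintro ⟨G, ⟨a, b⟩, c, e⟩ hw ⟨G', ⟨a', b'⟩, c', e'⟩ hw' hh
    simp only [Finset.coe_sigma, Set.mem_sigma_iff, Finset.mem_coe, switches,
      Finset.mem_filter, Finset.mem_univ, true_and] at hw hw'
    simp only [Sigma.mk.injEq, heq_eq_eq, Prod.mk.injEq] at hh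
    obtain ⟨h1, ⟨rfl, rfl⟩, rfl, rfl⟩ := hh
    have : G = G' := by rw [← hw.2.switch_undo, ← hw'.2.switch_undo, h1]
    rw [this]

lemma card_graphsWithCut_mul_le {d : V → ℕ} {Δ : ℕ} (hd3 : ∀ v, 3 ≤ d v) (hΔ : ∀ v, d v ≤ Δ)
    (A : Finset V) (c : ℕ) (hc : c ≤ 3 * Aᶜ.card) :
    ((graphsWithCut d A c).card : ℝ) *
        ((3 * A.card - c) * (3 * Aᶜ.card - c) - 2 * c * (Δ : ℝ) ^ 2) ≤
      (graphsWithCut d A (c + 2)).card * ((c + 2) * (c + 1)) := by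
  have hle : ((∑ G ∈ graphsWithCut d A c, (switches G A).card : ℕ) : ℝ) ≤
      (graphsWithCut d A (c + 2)).card * ((c + 2) * (c + 1)) := by
    exact_mod_cast sum_card_switches_le d A c
  refine le_trans ?_ hle
  push_cast
  rw [← nsmul_eq_mul]
  refine Finset.card_nsmul_le_sum _ _ _ fun G hG => ?_
  simp only [graphsWithCut, Finset.mem_filter, Finset.mem_univ, true_and] at hG
  have hs := card_switches G A (Δ := Δ) fun v => hG.1 v ▸ hΔ v
  have hins : ∀ B : Finset V, 3 * B.card ≤ (inside G B).card + (cut G B).card := fun B => by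
    rw [card_inside_add_card_cut, mul_comm, ← smul_eq_mul]
    exact Finset.card_nsmul_le_sum _ _ _ fun v _ => hG.1 v ▸ hd3 v
  have hA := hins A
  have hA' := hins Aᶜ
  rw [card_cut_compl, hG.2] at hA'
  rw [hG.2] at hA hs
  have hs' : ((inside G A).card : ℝ) * (inside G Aᶜ).card ≤
      (switches G A).card + 2 * (c * (Δ : ℝ) ^ 2) := by exact_mod_cast hs
  rify at hA hA' hc
  have := mul_le_mul (show (3 * A.card - c : ℝ) ≤ (inside G A).card by linarith)
    (show (3 * Aᶜ.card - c : ℝ) ≤ (inside G Aᶜ).card by linarith) (by linarith) (by positivity)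
  linarith

lemma card_graphsWithCut_zero_mul_prod_le {d : V → ℕ} {Δ : ℕ} (hd3 : ∀ v, 3 ≤ d v)
    (hΔ : ∀ v, d v ≤ Δ) (A : Finset V) (j : ℕ)
    (hj : 2 * j ≤ 3 * Aᶜ.card + 2)
    (hpos : ∀ i < j, 0 ≤
      (3 * A.card - 2 * i) * (3 * Aᶜ.card - 2 * i) - 4 * i * (Δ : ℝ) ^ 2) :
    ((graphsWithCut d A 0).card : ℝ) * ∏ i ∈ Finset.range j,
        ((3 * A.card - 2 * i) * (3 * Aᶜ.card - 2 * i) - 4 * i * (Δ : ℝ) ^ 2) ≤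
      (graphsWithCut d A (2 * j)).card *
        ∏ i ∈ Finset.range j, (((2 * i + 1) * (2 * i + 2) : ℝ)) := by
  induction j with
  | zero => simp
  | succ j ih =>
    rw [Finset.prod_range_succ, Finset.prod_range_succ, ← mul_assoc]
    have hstep := card_graphsWithCut_mul_le hd3 hΔ A (2 * j) (by lia)
    have ih' := ih (by lia) fun i hi => hpos i (by lia)
    have hp : (0 : ℝ) ≤ ∏ i ∈ Finset.range j, (((2 * i + 1) * (2 * i + 2) : ℝ)) := by positivity
    push_cast at hstep
    refine (mul_le_mul_of_nonneg_right ih' (hpos j (by lia))).trans ?_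
    have := mul_le_mul_of_nonneg_right hstep hp
    rw [show 2 * (j + 1) = 2 * j + 2 by ring]
    linarith

end Switching

section Numeric

lemma choose_eq_prod {n k : ℕ} (hk : k ≤ n) :
    (n.choose k : ℝ) = ∏ i ∈ Finset.range k, ((n - i : ℝ) / (i + 1)) := by
  have h := Nat.descFactorial_eq_factorial_mul_choose n k
  rw [Finset.prod_div_distrib, eq_div_iff (by positivity)]
  have h1 : ((n.descFactorial k : ℕ) : ℝ) = ∏ i ∈ Finset.range k, (n - i : ℝ) := by
    rw [Nat.descFactorial_eq_prod_range]
    push_cast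
    refine Finset.prod_congr rfl fun i hi => ?_
    rw [Nat.cast_sub ((Finset.mem_range.mp hi).le.trans hk)]
  have h2 : (k.factorial : ℝ) = ∏ i ∈ Finset.range k, (i + 1 : ℝ) := by
    rw [← Finset.prod_range_add_one_eq_factorial]
    push_cast
    rfl
  rw [← h1, ← h2, h]
  push_cast
  ring

lemma paired_factor_le {n k i j : ℝ} (hi : 0 ≤ i) (hj : 0 ≤ j) (hk : k = i + j + 1)
    (hn : 2 * k ≤ n) :
    (n - i) * (2 * (2 * i + 1)) / (9 / 10 * ((3 * k - 2 * i) * (3 * (n - k) - 2 * i))) *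
      ((n - j) * (2 * (2 * j + 1)) / (9 / 10 * ((3 * k - 2 * j) * (3 * (n - k) - 2 * j)))) ≤
      (23 / 25) ^ 2 := by
  obtain ⟨r, rfl⟩ : ∃ r, n = 2 * k + r := ⟨n - 2 * k, by ring⟩
  have hr : 0 ≤ r := by linarith
  subst hk
  have e1 : 3 * (i + j + 1) - 2 * i = i + 3 * j + 3 := by ring
  have e2 : 3 * (i + j + 1) - 2 * j = 3 * i + j + 3 := by ring
  have e3 : 3 * (2 * (i + j + 1) + r - (i + j + 1)) - 2 * i = i + 3 * j + 3 + 3 * r := by ring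
  have e4 : 3 * (2 * (i + j + 1) + r - (i + j + 1)) - 2 * j = 3 * i + j + 3 + 3 * r := by ring
  have e5 : 2 * (i + j + 1) + r - i = i + 2 * j + 2 + r := by ring
  have e6 : 2 * (i + j + 1) + r - j = 2 * i + j + 2 + r := by ring
  rw [e1, e2, e3, e4, e5, e6, div_mul_div_comm, div_le_iff₀ (by positivity)]
  have h1 : (2 * (2 * i + 1)) * (2 * (2 * j + 1)) ≤ (i + 3 * j + 3) * (3 * i + j + 3) := by
    nlinarith [sq_nonneg (i - j)]
  have h2 : 3 * ((i + 2 * j + 2 + r) * (2 * i + j + 2 + r)) ≤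
      2 * ((i + 3 * j + 3 + 3 * r) * (3 * i + j + 3 + 3 * r)) := by
    nlinarith [mul_nonneg hi hj, mul_nonneg hi hr, mul_nonneg hj hr, mul_nonneg hi hi,
      mul_nonneg hj hj, mul_nonneg hr hr]
  have h3 := mul_le_mul h1 h2 (by positivity) (by positivity)
  have h4 : 0 ≤ (i + 3 * j + 3) * (3 * i + j + 3) *
      ((i + 3 * j + 3 + 3 * r) * (3 * i + j + 3 + 3 * r)) := by positivity
  linarith

lemma half_le_factor {n k i : ℝ} (hk : 0 ≤ k) (hn : 2 * k ≤ n) (hik : i ≤ k) :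
    k * n / 2 ≤ (3 * k - 2 * i) * (3 * (n - k) - 2 * i) := by
  have := mul_le_mul (show k ≤ 3 * k - 2 * i by linarith)
    (show n / 2 ≤ 3 * (n - k) - 2 * i by linarith) (by linarith) (by linarith)
  linarith

lemma factor_sub_ge {n k i D : ℝ} (hk : 0 ≤ k) (hn : 2 * k ≤ n) (hi : 0 ≤ i) (hik : i ≤ k)
    (hD : 80 * D ≤ n) :
    9 / 10 * ((3 * k - 2 * i) * (3 * (n - k) - 2 * i)) ≤
      (3 * k - 2 * i) * (3 * (n - k) - 2 * i) - 4 * i * D := by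
  have h := half_le_factor hk hn hik
  have h2 : i * (80 * D) ≤ i * n := mul_le_mul_of_nonneg_left hD hi
  have h3 : i * n ≤ k * n := mul_le_mul_of_nonneg_right hik (by linarith)
  linarith

lemma choose_mul_prod_le {n k : ℕ} (hk : 1 ≤ k) (hn : 2 * k ≤ n) :
    (n.choose k : ℝ) * ∏ i ∈ Finset.range (k + 1), (((2 * i + 1) * (2 * i + 2) : ℝ) /
      (9 / 10 * ((3 * k - 2 * i) * (3 * (n - k) - 2 * i)))) ≤
      27 / n * (k * (23 / 25 : ℝ) ^ k) := by
  have hk' : (1 : ℝ) ≤ k := by exact_mod_cast hk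
  have hn' : (2 * k : ℝ) ≤ n := by exact_mod_cast hn
  have hpos : ∀ i : ℝ, i ≤ k → 0 < (3 * k - 2 * i) * (3 * (n - k) - 2 * i : ℝ) := fun i hi =>
    lt_of_lt_of_le (div_pos (mul_pos (by linarith) (by linarith)) two_pos)
      (half_le_factor (by linarith) hn' hi)
  set h : ℕ → ℝ := fun i => (n - i) * (2 * (2 * i + 1)) /
    (9 / 10 * ((3 * k - 2 * i) * (3 * (n - k) - 2 * i))) with h_def
  have hh : ∀ i ∈ Finset.range k, 0 ≤ h i := fun i hi => by
    have hi' : (i : ℝ) ≤ k := by exact_mod_cast (Finset.mem_range.mp hi).le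
    have := hpos i hi'
    have : (0 : ℝ) ≤ n - i := by linarith
    positivity
  have hprod : ∏ i ∈ Finset.range k, h i ≤ (23 / 25 : ℝ) ^ k := by
    refine le_of_sq_le_sq ?_ (by positivity)
    rw [sq]
    nth_rewrite 2 [← Finset.prod_range_reflect]
    rw [← Finset.prod_mul_distrib, ← pow_mul, mul_comm k, pow_mul]
    refine (Finset.prod_le_prod (g := fun _ => (23 / 25 : ℝ) ^ 2) (fun i hi => ?_)
      fun i hi => ?_).trans_eq (by simp)
    · have := Finset.mem_range.mp hi
      exact mul_nonneg (hh _ hi) (hh _ (Finset.mem_range.mpr (by lia)))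
    have hi' := Finset.mem_range.mp hi
    refine paired_factor_le (by positivity) (by positivity) ?_ hn'
    have : i + (k - 1 - i) + 1 = k := by lia
    exact_mod_cast this.symm
  have hlast : ((2 * k + 1) * (2 * k + 2) : ℝ) /
      (9 / 10 * ((3 * k - 2 * k) * (3 * (n - k) - 2 * k))) ≤ 27 / n * k := by
    have := half_le_factor (by linarith) hn' le_rfl
    rw [div_le_iff₀ (mul_pos (by norm_num) (hpos k le_rfl))]
    have hn0 : (0 : ℝ) < n := by linarith
    have h1 : 27 / n * k * (9 / 10 * (k * n / 2)) ≤ 27 / n * k *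
        (9 / 10 * ((3 * k - 2 * k) * (3 * (n - k) - 2 * k)) : ℝ) := by gcongr
    have h2 : 27 / n * k * (9 / 10 * (k * n / 2)) = (243 / 20 * k ^ 2 : ℝ) := by
      field_simp
      norm_num
    nlinarith
  rw [choose_eq_prod (by lia), Finset.prod_range_succ, ← mul_assoc, ← Finset.prod_mul_distrib]
  have heq : ∏ i ∈ Finset.range k, ((n - i : ℝ) / (i + 1) * (((2 * i + 1) * (2 * i + 2) : ℝ) /
      (9 / 10 * ((3 * k - 2 * i) * (3 * (n - k) - 2 * i))))) = ∏ i ∈ Finset.range k, h i := by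
    refine Finset.prod_congr rfl fun i _ => ?_
    rw [h_def, div_mul_div_comm, show (n - i : ℝ) * ((2 * i + 1) * (2 * i + 2)) =
      (i + 1) * ((n - i) * (2 * (2 * i + 1))) by ring, mul_div_mul_left _ _ (by positivity)]
  rw [heq]
  have := mul_le_mul hprod hlast (div_nonneg (by positivity)
    (mul_pos (by norm_num) (hpos k le_rfl)).le) (by positivity)
  linarith

lemma exists_sum_choose_mul_prod_le : ∃ K : ℝ, ∀ n : ℕ,
    ∑ k ∈ Finset.Icc 1 (n / 2), (n.choose k : ℝ) * ∏ i ∈ Finset.range (k + 1),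
      (((2 * i + 1) * (2 * i + 2) : ℝ) /
        (9 / 10 * ((3 * k - 2 * i) * (3 * (n - k) - 2 * i)))) ≤ K / n := by
  have hs : Summable fun k : ℕ => (k * (23 / 25 : ℝ) ^ k) := by
    simpa using summable_pow_mul_geometric_of_norm_lt_one 1 (r := (23 / 25 : ℝ)) (by norm_num)
  refine ⟨27 * ∑' k : ℕ, (k * (23 / 25 : ℝ) ^ k), fun n => ?_⟩
  calc _ ≤ ∑ k ∈ Finset.Icc 1 (n / 2), 27 / n * (k * (23 / 25 : ℝ) ^ k) := by
        refine Finset.sum_le_sum fun k hk => ?_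
        rw [Finset.mem_Icc] at hk
        exact choose_mul_prod_le hk.1 (by lia)
    _ = 27 / n * ∑ k ∈ Finset.Icc 1 (n / 2), (k * (23 / 25 : ℝ) ^ k) := by
        rw [Finset.mul_sum]
    _ ≤ 27 / n * ∑' k : ℕ, (k * (23 / 25 : ℝ) ^ k) := by
        gcongr
        exact hs.sum_le_tsum _ fun k _ => by positivity
    _ = _ := by ring

end Numeric

section Realization

variable {V : Type*} [Fintype V]

lemma card_adj_of_fst_mem (G : SimpleGraph V) (A : Finset V) :
    ((Finset.univ : Finset (V × V)).filter fun e => G.Adj e.1 e.2 ∧ e.1 ∈ A).card =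
      ∑ v ∈ A, G.degree v := by
  rw [← card_inside_add_card_cut, ← Finset.card_union_of_disjoint]
  · congr 1
    ext e
    simp only [inside, cut, Finset.mem_filter, Finset.mem_union, Finset.mem_univ, true_and]
    tauto
  · rw [Finset.disjoint_left]
    simp only [inside, cut, Finset.mem_filter]
    tauto

lemma exists_adj_avoiding (G : SimpleGraph V) (A B : Finset V)
    (h : ∑ v ∈ A, G.degree v + ∑ v ∈ B, G.degree v < ∑ v, G.degree v) :
    ∃ x y, G.Adj x y ∧ x ∉ A ∧ y ∉ B := by
  by_contra! hc
  have hB : ((Finset.univ : Finset (V × V)).filter fun e => G.Adj e.1 e.2 ∧ e.2 ∈ B).card ≤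
      ∑ v ∈ B, G.degree v := by
    rw [← card_adj_of_fst_mem]
    refine Finset.card_le_card_of_injOn Prod.swap ?_ Prod.swap_injective.injOn
    intro e he
    simp only [Finset.coe_filter, Finset.mem_univ, true_and, Set.mem_ofPred_eq] at he ⊢
    exact ⟨he.1.symm, he.2⟩
  have hsub : ((Finset.univ : Finset (V × V)).filter fun e => G.Adj e.1 e.2 ∧ e.1 ∈ Finset.univ) ⊆
      ((Finset.univ : Finset (V × V)).filter fun e => G.Adj e.1 e.2 ∧ e.1 ∈ A) ∪
        ((Finset.univ : Finset (V × V)).filter fun e => G.Adj e.1 e.2 ∧ e.2 ∈ B) := by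
    intro e he
    simp only [Finset.mem_filter, Finset.mem_union, Finset.mem_univ, true_and, and_true] at he ⊢
    by_cases hA : e.1 ∈ A
    · exact .inl ⟨he, hA⟩
    · exact .inr ⟨he, hc _ _ he hA⟩
  have := (Finset.card_le_card hsub).trans (Finset.card_union_le _ _)
  rw [card_adj_of_fst_mem, card_adj_of_fst_mem] at this
  lia

lemma degree_sup_edge {G H : SimpleGraph V} {u v : V} (hH : H = G ⊔ SimpleGraph.edge u v)
    (huv : u ≠ v) (h : ¬ G.Adj u v) (w : V) :
    H.degree w =
      G.degree w + ((if w = u then 1 else 0) + if w = v then 1 else 0) := by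
  zify
  rw [degree_eq_adjSum, degree_eq_adjSum, hH, adjSum_sup ((SimpleGraph.disjoint_edge _).2 h),
    adjSum_edge huv]
  simp only [eq_comm (a := w)]

/-- Replacing the edge `xy` by `ux` and `vy` raises the degrees of `u` and `v` only. -/
lemma degree_reroute {G H : SimpleGraph V} {u v x y : V}
    (hH : H = (G \ SimpleGraph.edge x y) ⊔ (SimpleGraph.edge u x ⊔ SimpleGraph.edge v y))
    (hxy : G.Adj x y) (hux : ¬ G.Adj u x)
    (hvy : ¬ G.Adj v y) (hxu : x ≠ u) (hyv : y ≠ v) (hxv : x ≠ v) (w : V) :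
    H.degree w =
      G.degree w + ((if w = u then 1 else 0) + if w = v then 1 else 0) := by
  zify
  rw [degree_eq_adjSum, degree_eq_adjSum, hH, adjSum_sup, adjSum_sdiff, adjSum_sup,
    adjSum_edge hxy.ne, adjSum_edge hxu.symm, adjSum_edge hyv.symm]
  · simp only [eq_comm (a := w)]
    ring
  · refine (SimpleGraph.disjoint_edge _).2 ?_
    have := hxy.ne
    rw [SimpleGraph.edge_adj]
    rintro ⟨⟨-, h⟩ | ⟨h, -⟩, -⟩
    exacts [this h.symm, hxv h.symm]
  · exact (SimpleGraph.edge_le_iff _).2 (.inr hxy)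
  · exact Disjoint.mono_left sdiff_le <| ((SimpleGraph.disjoint_edge _).2 hux).sup_right
      ((SimpleGraph.disjoint_edge _).2 hvy)

/-- A sequence with even sum whose maximum is small compared with the number of vertices is the
degree sequence of a simple graph. -/
theorem exists_degree_eq {d : V → ℕ} {Δ : ℕ} (hd3 : ∀ v, 3 ≤ d v) (hΔ : ∀ v, d v ≤ Δ)
    (heven : Even (∑ v, d v)) (hcard : (2 * Δ + 3) * (Δ + 1) < 3 * Fintype.card V) :
    ∃ G : SimpleGraph V, ∀ v, G.degree v = d v := by
  obtain ⟨G, hG, hmax⟩ := Finset.exists_max_image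
    (Finset.univ.filter fun G : SimpleGraph V => ∀ v, G.degree v ≤ d v)
    (fun G => ∑ v, G.degree v) ⟨⊥, by simp⟩
  simp only [Finset.mem_filter, Finset.mem_univ, true_and] at hG hmax
  refine ⟨G, ?_⟩
  by_contra! hne
  obtain ⟨u, hu⟩ := hne
  have hu : G.degree u < d u := lt_of_le_of_ne (hG u) hu
  have hno : ∀ (v : V) (G' : SimpleGraph V), (∀ w, G'.degree w =
      G.degree w + ((if w = u then 1 else 0) + if w = v then 1 else 0)) →
      ¬ ∀ w, G.degree w + ((if w = u then 1 else 0) + if w = v then 1 else 0) ≤ d w := by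
    intro v G' hG' hle
    have := hmax G' fun w => (hG' w).trans_le (hle w)
    simp [hG', Finset.sum_add_distrib] at this
  have hadj : ∀ w, w ≠ u → G.degree w < d w → G.Adj u w := by
    intro w hwu hw
    by_contra h
    refine hno w _ (degree_sup_edge rfl hwu.symm h) fun z => ?_
    have := hG z
    by_cases h1 : z = u
    · subst h1
      simp [hwu.symm]
      lia
    · by_cases h2 : z = w
      · subst h2
        simp [hwu]
        lia
      · simpa [h1, h2] using this
  obtain ⟨v, hv⟩ : ∃ v, ∀ w,
      G.degree w + ((if w = u then 1 else 0) + if w = v then 1 else 0) ≤ d w := by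
    by_contra! hc
    have hd : ∀ w, d w = G.degree w + if w = u then 1 else 0 := by
      intro w
      obtain ⟨z, hz⟩ := hc w
      have := hG z
      have := hG w
      by_cases h1 : w = u <;> by_cases h2 : z = u <;> by_cases h3 : z = w <;> grind
    have hsum : ∑ w, d w = ∑ w, G.degree w + 1 := by
      simp [hd, Finset.sum_add_distrib]
    rw [hsum, G.sum_degrees_eq_twice_card_edges] at heven
    exact (Nat.not_even_iff_odd.2 ⟨_, rfl⟩) heven
  have hvd : G.degree v < d v := by
    have := hv v
    simp only [if_true] at this
    lia
  have hcardI : ∀ w, (insert w (G.neighborFinset w)).card ≤ Δ + 1 := fun w =>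
    (Finset.card_insert_le _ _).trans (Nat.succ_le_succ ((hG w).trans (hΔ w)))
  have hsumI : ∀ w, ∑ z ∈ insert w (G.neighborFinset w), G.degree z ≤ (Δ + 1) * Δ := fun w =>
    (Finset.sum_le_card_nsmul _ _ Δ fun z _ => (hG z).trans (hΔ z)).trans
      (Nat.mul_le_mul_right _ (hcardI w))
  have htotal : 3 * Fintype.card V ≤ 3 * (Δ + 1) + ∑ w, G.degree w := by
    have h1 : 3 * (insert u (G.neighborFinset u))ᶜ.card ≤
        ∑ w ∈ (insert u (G.neighborFinset u))ᶜ, G.degree w := by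
      rw [mul_comm, ← smul_eq_mul]
      refine Finset.card_nsmul_le_sum _ _ _ fun w hw => ?_
      simp only [Finset.mem_compl, Finset.mem_insert, SimpleGraph.mem_neighborFinset,
        not_or] at hw
      have := hd3 w
      by_contra h
      exact hw.2 (hadj w hw.1 (by lia))
    have h2 := Finset.sum_le_univ_sum_of_nonneg (f := fun w => G.degree w)
      (s := (insert u (G.neighborFinset u))ᶜ) fun _ => Nat.zero_le _
    have h3 := Finset.card_add_card_compl (insert u (G.neighborFinset u))
    have h4 := hcardI u
    lia
  obtain ⟨x, y, hxy, hx, hy⟩ := exists_adj_avoiding G (insert u (G.neighborFinset u))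
    (insert v (G.neighborFinset v)) (by linarith [hsumI u, hsumI v])
  simp only [Finset.mem_insert, SimpleGraph.mem_neighborFinset, not_or] at hx hy
  have hxv : x ≠ v := by
    rintro rfl
    exact hx.2 (hadj _ hx.1 hvd)
  exact hno v _ (degree_reroute rfl hxy hx.2 hy.2 hx.1 hy.1 hxv) hv

end Realization

section Disconnected

variable {V : Type*} [Fintype V]

lemma exists_cut_eq_empty [Nonempty V] {G : SimpleGraph V} (h : ¬ G.Connected) :
    ∃ A : Finset V, A.Nonempty ∧ 2 * A.card ≤ Fintype.card V ∧ cut G A = ∅ := by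
  have hpre : ¬ G.Preconnected := fun hp => h ⟨hp⟩
  simp only [SimpleGraph.Preconnected, not_forall] at hpre
  obtain ⟨u, v, huv⟩ := hpre
  set A : Finset V := Finset.univ.filter fun w => G.Reachable u w with hA
  have hcut : cut G A = ∅ := by
    rw [cut, Finset.filter_eq_empty_iff]
    rintro ⟨x, y⟩ - ⟨hxy, hx, hy⟩
    simp only [hA, Finset.mem_filter, Finset.mem_univ, true_and] at hx hy
    exact hy (hx.trans hxy.reachable)
  have hcard := Finset.card_add_card_compl A
  by_cases hle : 2 * A.card ≤ Fintype.card V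
  · exact ⟨A, ⟨u, by simp [hA]⟩, hle, hcut⟩
  · refine ⟨Aᶜ, ⟨v, by simpa [hA] using huv⟩, by lia, ?_⟩
    rw [← Finset.card_eq_zero, card_cut_compl, hcut, Finset.card_empty]

/-- The graphs with degree sequence `d`. -/
def degreeGraphs (d : V → ℕ) : Finset (SimpleGraph V) :=
  Finset.univ.filter fun G => ∀ v, G.degree v = d v

/-- The disconnected graphs with degree sequence `d`. -/
def disconnectedGraphs (d : V → ℕ) : Finset (SimpleGraph V) :=
  (degreeGraphs d).filter fun G => ¬ G.Connected

lemma card_graphsWithCut_zero_le {d : V → ℕ} {Δ : ℕ} (hd3 : ∀ v, 3 ≤ d v) (hΔ : ∀ v, d v ≤ Δ)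
    (hcard : 80 * Δ ^ 2 ≤ Fintype.card V) {A : Finset V} (hA : A.Nonempty)
    (hA2 : 2 * A.card ≤ Fintype.card V) :
    ((graphsWithCut d A 0).card : ℝ) ≤ (degreeGraphs d).card *
      ∏ i ∈ Finset.range (A.card + 1), (((2 * i + 1) * (2 * i + 2) : ℝ) /
        (9 / 10 * ((3 * A.card - 2 * i) * (3 * (Fintype.card V - A.card) - 2 * i)))) := by
  set k := A.card with hk
  set n := Fintype.card V with hn
  have hk1 : 1 ≤ k := hA.card_pos
  have hcompl : k + Aᶜ.card = n := Finset.card_add_card_compl A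
  have hcompl' : (Aᶜ.card : ℝ) = n - k := by
    rw [← hcompl]
    push_cast
    ring
  have hk' : (1 : ℝ) ≤ k := by exact_mod_cast hk1
  have hn' : (2 * k : ℝ) ≤ n := by exact_mod_cast hA2
  have hD : (80 * (Δ : ℝ) ^ 2) ≤ n := by exact_mod_cast hcard
  have hik : ∀ i < k + 1, (i : ℝ) ≤ k := fun i hi => by exact_mod_cast Nat.lt_succ_iff.mp hi
  have hpos : ∀ i < k + 1,
      0 < 9 / 10 * ((3 * k - 2 * i) * (3 * (n - k) - 2 * i) : ℝ) := fun i hi =>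
    mul_pos (by norm_num) (lt_of_lt_of_le (div_pos (mul_pos (by linarith) (by linarith)) two_pos)
      (half_le_factor (by linarith) hn' (hik i hi)))
  have hge : ∀ i < k + 1, 9 / 10 * ((3 * k - 2 * i) * (3 * (n - k) - 2 * i) : ℝ) ≤
      (3 * k - 2 * i) * (3 * (n - k) - 2 * i) - 4 * i * (Δ : ℝ) ^ 2 := fun i hi =>
    factor_sub_ge (by linarith) hn' (by positivity) (hik i hi) hD
  have hmain := card_graphsWithCut_zero_mul_prod_le hd3 hΔ A (k + 1) (by lia) fun i hi => by
    rw [hcompl']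
    exact (hpos i hi).le.trans (hge i hi)
  rw [hcompl'] at hmain
  have hsub : (graphsWithCut d A (2 * (k + 1))).card ≤ (degreeGraphs d).card :=
    Finset.card_le_card fun G hG => by
      simp only [graphsWithCut, degreeGraphs, Finset.mem_filter] at hG ⊢
      exact ⟨hG.1, hG.2.1⟩
  have hprod_pos : (0 : ℝ) < ∏ i ∈ Finset.range (k + 1),
      (9 / 10 * ((3 * k - 2 * i) * (3 * (n - k) - 2 * i) : ℝ)) :=
    Finset.prod_pos fun i hi => hpos i (Finset.mem_range.mp hi)
  rw [Finset.prod_div_distrib, ← mul_div_assoc, le_div_iff₀ hprod_pos]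
  calc _ ≤ ((graphsWithCut d A 0).card : ℝ) * ∏ i ∈ Finset.range (k + 1),
        ((3 * k - 2 * i) * (3 * (n - k) - 2 * i) - 4 * i * (Δ : ℝ) ^ 2) := by
        refine mul_le_mul_of_nonneg_left ?_ (by positivity)
        exact Finset.prod_le_prod (fun i hi => (hpos i (Finset.mem_range.mp hi)).le)
          fun i hi => hge i (Finset.mem_range.mp hi)
    _ ≤ _ := hmain
    _ ≤ _ := mul_le_mul_of_nonneg_right (by exact_mod_cast hsub) (by positivity)

lemma card_disconnectedGraphs_le [Nonempty V] {d : V → ℕ} {Δ : ℕ} (hd3 : ∀ v, 3 ≤ d v)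
    (hΔ : ∀ v, d v ≤ Δ) (hcard : 80 * Δ ^ 2 ≤ Fintype.card V) :
    ((disconnectedGraphs d).card : ℝ) ≤ (degreeGraphs d).card *
      ∑ k ∈ Finset.Icc 1 (Fintype.card V / 2), ((Fintype.card V).choose k : ℝ) *
        ∏ i ∈ Finset.range (k + 1), (((2 * i + 1) * (2 * i + 2) : ℝ) /
          (9 / 10 * ((3 * k - 2 * i) * (3 * (Fintype.card V - k) - 2 * i)))) := by
  have hsub : disconnectedGraphs d ⊆
      (Finset.Icc 1 (Fintype.card V / 2)).biUnion fun k =>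
        (Finset.powersetCard k Finset.univ).biUnion fun A => graphsWithCut d A 0 := by
    intro G hG
    rw [disconnectedGraphs, Finset.mem_filter] at hG
    obtain ⟨A, hA, hA2, hcut⟩ := exists_cut_eq_empty hG.2
    have hd := hG.1
    simp only [degreeGraphs, Finset.mem_filter, Finset.mem_univ, true_and] at hd
    simp only [Finset.mem_biUnion, Finset.mem_Icc, Finset.mem_powersetCard, Finset.subset_univ,
      true_and, graphsWithCut, Finset.mem_filter, Finset.mem_univ]
    exact ⟨A.card, ⟨hA.card_pos, by lia⟩, A, rfl, hd, by simp [hcut]⟩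
  have h := (Finset.card_le_card hsub).trans (Finset.card_biUnion_le.trans
    (Finset.sum_le_sum fun k _ => Finset.card_biUnion_le))
  refine (Nat.cast_le.mpr h).trans ?_
  push_cast
  rw [Finset.mul_sum]
  refine Finset.sum_le_sum fun k hk => ?_
  rw [Finset.mem_Icc] at hk
  rw [mul_left_comm, ← Finset.card_univ, ← Finset.card_powersetCard, ← nsmul_eq_mul,
    Finset.card_univ]
  refine Finset.sum_le_card_nsmul _ _ _ fun A hA => ?_
  obtain rfl := (Finset.mem_powersetCard.mp hA).2
  exact card_graphsWithCut_zero_le hd3 hΔ hcard (Finset.card_pos.mp hk.1) (by lia)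

end Disconnected

section Limit

lemma uniformGraph_not_connected_le {n : ℕ} (hn : 0 < n) {d : Fin n → ℕ} {Δ : ℕ} {ε : ℝ}
    (hd3 : ∀ v, 3 ≤ d v) (hΔ : ∀ v, d v ≤ Δ) (hcard : 80 * Δ ^ 2 ≤ n)
    (hε : ∑ k ∈ Finset.Icc 1 (n / 2), (n.choose k : ℝ) * ∏ i ∈ Finset.range (k + 1),
      (((2 * i + 1) * (2 * i + 2) : ℝ) /
        (9 / 10 * ((3 * k - 2 * i) * (3 * (n - k) - 2 * i)))) ≤ ε)
    (hne : ∃ G : SimpleGraph (Fin n), ∀ v, G.degree v = d v) :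
    uniformGraph n d {G | ¬ G.Connected} ≤ ENNReal.ofReal ε := by
  have : Nonempty (Fin n) := ⟨⟨0, hn⟩⟩
  have h := card_disconnectedGraphs_le hd3 hΔ (by simpa using hcard)
  rw [Fintype.card_fin] at h
  obtain ⟨G₀, hG₀⟩ := hne
  have hpos : (0 : ℝ) < (degreeGraphs d).card := by
    exact_mod_cast Finset.card_pos.mpr ⟨G₀, by simpa [degreeGraphs] using hG₀⟩
  have hS : {G : SimpleGraph (Fin n) | ∀ i, G.degree i = d i} =
      (degreeGraphs d : Set (SimpleGraph (Fin n))) := by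
    ext G
    simp [degreeGraphs]
  have hST : (degreeGraphs d : Set (SimpleGraph (Fin n))) ∩ {G | ¬ G.Connected} =
      (disconnectedGraphs d : Set (SimpleGraph (Fin n))) := by
    ext G
    simp [disconnectedGraphs]
  have hmeas : ∀ s : Set (SimpleGraph (Fin n)), MeasurableSet s := fun _ => trivial
  rw [uniformGraph, hS, uniformOn, cond_apply (hmeas _), hST,
    Measure.count_apply_finset' (hmeas _), Measure.count_apply_finset' (hmeas _), mul_comm,
    ← div_eq_mul_inv]
  refine ENNReal.div_le_of_le_mul ?_
  rw [← ENNReal.ofReal_natCast, ← ENNReal.ofReal_natCast, ← ENNReal.ofReal_mul' hpos.le]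
  refine ENNReal.ofReal_le_ofReal (h.trans ?_)
  rw [mul_comm]
  exact mul_le_mul_of_nonneg_right hε hpos.le

lemma DegreeCondition.three_le {d : ∀ n : ℕ, Fin n → ℕ} {p : ℕ → ℝ} {dmin : ℕ}
    (hcond : DegreeCondition d p dmin) (n : ℕ) (v : Fin n) : 3 ≤ d n v := by
  have hmin := hcond.min_eq n (Nat.pos_of_ne_zero fun h => (h ▸ v).elim0)
  exact hcond.min_ge.trans (hmin ▸ Nat.sInf_le ⟨v, rfl⟩)

lemma DegreeCondition.eventually_sq_sup_le {d : ∀ n : ℕ, Fin n → ℕ} {p : ℕ → ℝ} {dmin : ℕ}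
    (hcond : DegreeCondition d p dmin) :
    ∀ᶠ n in atTop, 80 * (Finset.univ.sup (d n)) ^ 2 ≤ n := by
  obtain ⟨τ, hτ, C, hC⟩ := hcond.max_bound
  have hlim : Tendsto (fun n : ℕ => 80 * C ^ 2 * (n : ℝ) ^ (-(2 * τ))) atTop (nhds 0) := by
    simpa using ((tendsto_rpow_neg_atTop (by positivity : 0 < 2 * τ)).comp
      tendsto_natCast_atTop_atTop).const_mul (80 * C ^ 2)
  filter_upwards [hlim.eventually_le_const one_pos, eventually_gt_atTop 0] with n hn hn0
  have hn0' : (0 : ℝ) < n := by exact_mod_cast hn0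
  have hsq : ((n : ℝ) ^ ((1 : ℝ) / 2 - τ)) ^ 2 = n * (n : ℝ) ^ (-(2 * τ)) := by
    have hadd := Real.rpow_add hn0' 1 (-(2 * τ))
    rw [Real.rpow_one] at hadd
    rw [← hadd, ← Real.rpow_natCast, ← Real.rpow_mul hn0'.le]
    congr 1
    push_cast
    ring
  have h := pow_le_pow_left₀ (Nat.cast_nonneg _) (hC n) 2
  rw [mul_pow, hsq] at h
  have h2 := mul_le_mul_of_nonneg_left hn hn0'.le
  have : (80 * ((Finset.univ.sup (d n) : ℕ) : ℝ) ^ 2) ≤ n := by linarith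
  exact_mod_cast this

end Limit

/-- under Condition 1, `G(n,(d_i)_1^n)` is connected w.h.p. -/
theorem connected_whp
    (d : ∀ n : ℕ, Fin n → ℕ) (p : ℕ → ℝ) (dmin : ℕ)
    (hcond : DegreeCondition d p dmin) :
    Tendsto (fun n : ℕ => uniformGraph n (d n) {G | G.Connected}) atTop (nhds 1) := by
  obtain ⟨K, hK⟩ := exists_sum_choose_mul_prod_le
  have hlim : Tendsto (fun n : ℕ => ENNReal.ofReal (K / n)) atTop (nhds 0) := by
    simpa using ENNReal.tendsto_ofReal (tendsto_const_div_atTop_nhds_zero_nat K)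
  have hev : ∀ᶠ n in atTop, IsProbabilityMeasure (uniformGraph n (d n)) ∧
      uniformGraph n (d n) {G | ¬ G.Connected} ≤ ENNReal.ofReal (K / n) := by
    filter_upwards [hcond.eventually_sq_sup_le, eventually_gt_atTop 0] with n hn hn0
    have hΔ : ∀ v, d n v ≤ Finset.univ.sup (d n) := fun v => Finset.le_sup (Finset.mem_univ v)
    have h3 : 3 ≤ Finset.univ.sup (d n) := (hcond.three_le n ⟨0, hn0⟩).trans (hΔ _)
    have hne := exists_degree_eq (hcond.three_le n) hΔ (hcond.even_sum n)
      (by rw [Fintype.card_fin]; nlinarith)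
    refine ⟨?_, uniformGraph_not_connected_le hn0 (hcond.three_le n) hΔ hn (hK n) hne⟩
    have : MeasurableSingletonClass (SimpleGraph (Fin n)) := ⟨fun _ => trivial⟩
    exact isProbabilityMeasure_uniformOn (Set.toFinite _) hne
  have hcompl : Tendsto (fun n : ℕ => uniformGraph n (d n) {G | ¬ G.Connected}) atTop (nhds 0) :=
    tendsto_of_tendsto_of_tendsto_of_le_of_le' tendsto_const_nhds hlim
      (Eventually.of_forall fun _ => zero_le) (hev.mono fun _ h => h.2)
  have hsub := ENNReal.Tendsto.sub (tendsto_const_nhds (x := (1 : ENNReal))) hcompl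
    (.inl ENNReal.one_ne_top)
  rw [tsub_zero] at hsub
  refine hsub.congr' (hev.mono fun n hn => ?_)
  have := hn.1
  have h := prob_compl_eq_one_sub (μ := uniformGraph n (d n))
    (s := {G | ¬ G.Connected}) trivial
  rw [← h]
  congr 1
  ext G
  simp

end Flooding
end
end

section
/- Let D̲_1^{(n)}, D̲_2^{(n)}, … be i.i.d. random variables with distribution π̲^{(n)}, where the degree sequence satisfies Condition 1 with size-biased limit distribution q of mean ν. For any η < ν there exists a constant γ > 0 such that for all n large enough and all k ≥ 1, P( D̲_1^{(n)} + … + D̲_k^{(n)} ≤ kη ) ≤ e^{−γk}. -/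
open MeasureTheory ProbabilityTheory Filter

noncomputable section

attribute [local instance] Classical.propDecidable

namespace Flooding

/-- Ascending order statistics of the degree sequence: `degOrd dseq i = d_{(i+1)}`. -/
def degOrd {n : ℕ} (dseq : Fin n → ℕ) : Fin n → ℕ := dseq ∘ Tuple.sort dseq

/-- `π̲^{(n)}` (as a measure on ℕ): the size-biased empirical degree distribution with the
`b` highest degrees removed, shifted down by one. -/
def piLow {n : ℕ} (dseq : Fin n → ℕ) (b : ℕ) : Measure ℕ :=
  Measure.sum fun k : ℕ =>
    (ENNReal.ofReal
      ((∑ i : Fin n, if i.val + 1 ≤ n - b ∧ degOrd dseq i = k + 1 then ((k : ℝ) + 1) else 0) /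
        (∑ i : Fin n, if i.val + 1 ≤ n - b then (degOrd dseq i : ℝ) else 0))) • Measure.dirac k

/-- `π̄^{(n)}` (as a measure on ℕ): the size-biased empirical degree distribution with the
`c` lowest degrees removed, shifted down by one. -/
def piHigh {n : ℕ} (dseq : Fin n → ℕ) (c : ℕ) : Measure ℕ :=
  Measure.sum fun k : ℕ =>
    (ENNReal.ofReal
      ((∑ i : Fin n, if c ≤ i.val + 1 ∧ degOrd dseq i = k + 1 then ((k : ℝ) + 1) else 0) /
        (∑ i : Fin n, if c ≤ i.val + 1 then (degOrd dseq i : ℝ) else 0))) • Measure.dirac k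

end Flooding

namespace Flooding

theorem exp_neg_le_one_sub_add_sq {x : ℝ} (hx : 0 ≤ x) : Real.exp (-x) ≤ 1 - x + x ^ 2 := by
  have h1 : 1 + x ≤ Real.exp x := by linarith [Real.add_one_le_exp x]
  rw [Real.exp_neg, inv_le_iff_one_le_mul₀ (Real.exp_pos x)]
  calc (1 : ℝ) ≤ (1 - x + x ^ 2) * (1 + x) := by nlinarith [pow_nonneg hx 3]
    _ ≤ (1 - x + x ^ 2) * Real.exp x :=
      mul_le_mul_of_nonneg_left h1 (by nlinarith [sq_nonneg (x - 1), sq_nonneg x])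

/-- A Chernoff bound for sums of independent natural numbers with common law `μ`. -/
theorem pi_sum_le_le_of_integral_exp_le (μ : Measure ℕ) [IsFiniteMeasure μ] {θ η c : ℝ}
    (hθ : 0 < θ) (h : ∫ x : ℕ, Real.exp (-θ * x) ∂μ ≤ c) (k : ℕ) :
    (Measure.map (fun f : Fin k → ℕ => ∑ i, f i) (Measure.pi fun _ : Fin k => μ))
        {s : ℕ | (s : ℝ) ≤ k * η} ≤ ENNReal.ofReal ((c * Real.exp (θ * η)) ^ k) := by
  have hint : Integrable (fun x : ℕ => Real.exp (-θ * x)) μ := by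
    refine Integrable.of_bound (C := 1) (by fun_prop) (ae_of_all _ fun x => ?_)
    rw [Real.norm_eq_abs, Real.abs_exp, Real.exp_le_one_iff]
    have : (0 : ℝ) ≤ θ * x := by positivity
    linarith
  have hprod : Integrable (fun f : Fin k → ℕ => ∏ i, Real.exp (-θ * f i))
      (Measure.pi fun _ : Fin k => μ) :=
    Integrable.fintype_prod (f := fun _ (x : ℕ) => Real.exp (-θ * x)) fun _ => hint
  have hmarkov := mul_meas_ge_le_integral_of_nonneg
    (ae_of_all _ fun f => Finset.prod_nonneg fun i _ => (Real.exp_pos (-θ * f i)).le) hprod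
    (Real.exp (-θ * (k * η)))
  rw [integral_fintype_prod_eq_prod (f := fun _ (x : ℕ) => Real.exp (-θ * x)), Finset.prod_const,
    Finset.card_univ, Fintype.card_fin] at hmarkov
  rw [Measure.map_apply (by fun_prop) (MeasurableSet.of_discrete)]
  have hset : ((fun f : Fin k → ℕ => ∑ i, f i) ⁻¹' {s : ℕ | (s : ℝ) ≤ k * η}) =
      {f : Fin k → ℕ | Real.exp (-θ * (k * η)) ≤ ∏ i, Real.exp (-θ * f i)} := by
    ext f
    simp only [Set.mem_preimage, Set.mem_ofPred_eq, ← Real.exp_sum, Real.exp_le_exp,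
      ← Finset.mul_sum, Nat.cast_sum]
    constructor
    · intro h; nlinarith
    · intro h; nlinarith
  rw [hset, ← ofReal_measureReal]
  refine ENNReal.ofReal_le_ofReal ?_
  have h0 : (0 : ℝ) ≤ ∫ x : ℕ, Real.exp (-θ * x) ∂μ := integral_nonneg fun _ => (Real.exp_pos _).le
  have h1 := hmarkov.trans (pow_le_pow_left₀ h0 h k)
  rw [mul_pow, ← Real.exp_nat_mul, mul_comm (c ^ k)]
  calc _ = Real.exp (k * (θ * η)) * (Real.exp (-θ * (k * η)) *
        (Measure.pi fun _ : Fin k => μ).real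
          {f : Fin k → ℕ | Real.exp (-θ * (k * η)) ≤ ∏ i, Real.exp (-θ * f i)}) := by
        rw [← mul_assoc (Real.exp _), ← Real.exp_add, show (k : ℝ) * (θ * η) + -θ * (k * η) = 0 by ring,
          Real.exp_zero, one_mul]
    _ ≤ _ := mul_le_mul_of_nonneg_left h1 (Real.exp_pos _).le

theorem isFiniteMeasure_sum_ofReal_dirac {w : ℕ → ℝ} (hw : ∀ j, 0 ≤ w j) (hs : Summable w) :
    IsFiniteMeasure (Measure.sum fun j : ℕ => ENNReal.ofReal (w j) • Measure.dirac j) := by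
  refine ⟨?_⟩
  rw [Measure.sum_apply _ MeasurableSet.univ]
  simp only [Measure.smul_apply, measure_univ, smul_eq_mul, mul_one]
  rw [← ENNReal.ofReal_tsum_of_nonneg hw hs]
  exact ENNReal.ofReal_lt_top

theorem integral_sum_ofReal_dirac {w f : ℕ → ℝ} (hw : ∀ j, 0 ≤ w j) (hf : ∀ j, 0 ≤ f j)
    (hs : Summable fun j => w j * f j) :
    ∫ x, f x ∂(Measure.sum fun j : ℕ => ENNReal.ofReal (w j) • Measure.dirac j) =
      ∑' j, w j * f j := by
  rw [integral_eq_lintegral_of_nonneg_ae (ae_of_all _ hf) (by fun_prop), lintegral_sum_measure]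
  simp only [lintegral_smul_measure, lintegral_dirac, smul_eq_mul, ← ENNReal.ofReal_mul (hw _)]
  rw [← ENNReal.ofReal_tsum_of_nonneg (fun j => mul_nonneg (hw j) (hf j)) hs,
    ENNReal.toReal_ofReal (tsum_nonneg fun j => mul_nonneg (hw j) (hf j))]

/-- If a law on `ℕ` of mass at most one has truncated mean at least `m > η`, the probability that
the sum of `k` independent samples is at most `k * η` decays exponentially in `k`, at a rate
depending only on `m - η` and the truncation level `M`. -/
theorem pi_sum_le_le_exp_of_truncated_mean {w : ℕ → ℝ} (hw : ∀ j, 0 ≤ w j) (hs : Summable w)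
    (h1 : ∑' j, w j ≤ 1) {M : ℕ} {m η : ℝ} (hm : m ≤ ∑ j ∈ Finset.range M, (j : ℝ) * w j)
    (hη : η < m) (k : ℕ) :
    (Measure.map (fun f : Fin k → ℕ => ∑ i, f i) (Measure.pi fun _ : Fin k =>
        Measure.sum fun j : ℕ => ENNReal.ofReal (w j) • Measure.dirac j))
      {s : ℕ | (s : ℝ) ≤ k * η} ≤
      ENNReal.ofReal (Real.exp (-((m - η) ^ 2 / (4 * ((M : ℝ) ^ 2 + 1))) * k)) := by
  have := isFiniteMeasure_sum_ofReal_dirac hw hs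
  set K : ℝ := (M : ℝ) ^ 2 + 1 with hK
  have hKpos : 0 < K := by positivity
  set θ : ℝ := (m - η) / (2 * K) with hθdef
  have hθ : 0 < θ := div_pos (by linarith) (by positivity)
  have hle1 : ∀ j : ℕ, Real.exp (-θ * j) ≤ 1 := fun j => by
    have : (0 : ℝ) ≤ θ * j := by positivity
    rw [Real.exp_le_one_iff]; linarith
  have hse : Summable fun j => w j * Real.exp (-θ * j) :=
    Summable.of_nonneg_of_le (fun j => mul_nonneg (hw j) (Real.exp_pos _).le)
      (fun j => mul_le_of_le_one_right (hw j) (hle1 j)) hs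
  have hpt : ∀ j : ℕ, w j * Real.exp (-θ * j) ≤
      w j * (1 + θ ^ 2 * K) - (if j ∈ Finset.range M then θ * (j * w j) else 0) := fun j => by
    split_ifs with hj
    · have hjM : (j : ℝ) ≤ M := by exact_mod_cast (Finset.mem_range.1 hj).le
      have hj2 : (j : ℝ) ^ 2 ≤ K := by nlinarith [Nat.cast_nonneg (α := ℝ) j]
      have hexp := exp_neg_le_one_sub_add_sq (x := θ * j) (by positivity)
      rw [← neg_mul] at hexp
      have : Real.exp (-θ * j) ≤ 1 - θ * j + θ ^ 2 * K :=
        hexp.trans (by nlinarith [mul_le_mul_of_nonneg_left hj2 (sq_nonneg θ)])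
      nlinarith [mul_le_mul_of_nonneg_left this (hw j)]
    · rw [sub_zero]
      exact mul_le_mul_of_nonneg_left
        ((hle1 j).trans (by nlinarith [mul_pos (pow_pos hθ 2) hKpos])) (hw j)
  have hfin : HasSum (fun j : ℕ => if j ∈ Finset.range M then θ * (j * w j) else 0)
      (∑ j ∈ Finset.range M, θ * (j * w j)) := by
    have := hasSum_sum_of_ne_finset_zero (L := .unconditional ℕ)
      (f := fun j : ℕ => if j ∈ Finset.range M then θ * (j * w j) else 0) (s := Finset.range M)
      (fun j hj => if_neg hj)
    rwa [Finset.sum_congr rfl fun j hj => if_pos hj] at this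
  have hmgf : ∫ x : ℕ, Real.exp (-θ * x)
      ∂(Measure.sum fun j : ℕ => ENNReal.ofReal (w j) • Measure.dirac j) ≤
      Real.exp (θ ^ 2 * K - θ * m) := by
    rw [integral_sum_ofReal_dirac hw (fun j => (Real.exp_pos _).le) hse]
    have h := hasSum_le hpt hse.hasSum ((hs.hasSum.mul_right (1 + θ ^ 2 * K)).sub hfin)
    rw [← Finset.mul_sum] at h
    have hθK : 0 ≤ θ ^ 2 * K := by positivity
    have h2 : (∑' j, w j) * (1 + θ ^ 2 * K) ≤ 1 + θ ^ 2 * K :=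
      mul_le_of_le_one_left (by linarith) h1
    linarith [mul_le_mul_of_nonneg_left hm hθ.le, Real.add_one_le_exp (θ ^ 2 * K - θ * m)]
  refine (pi_sum_le_le_of_integral_exp_le _ (η := η) hθ hmgf k).trans_eq ?_
  rw [← Real.exp_add, ← Real.exp_nat_mul]
  congr 2
  rw [hθdef]
  field_simp
  ring

section DegreeSequence

variable {n : ℕ} (dseq : Fin n → ℕ) (b : ℕ)

theorem sum_degOrd_eq {M : Type*} [AddCommMonoid M] (f : ℕ → M) :
    ∑ i, f (degOrd dseq i) = ∑ i, f (dseq i) :=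
  Equiv.sum_comp (Tuple.sort dseq) fun i => f (dseq i)

/-- The unnormalized masses of `piLow`. -/
def lowMass (j : ℕ) : ℝ :=
  ∑ i : Fin n, if i.val + 1 ≤ n - b ∧ degOrd dseq i = j + 1 then ((j : ℝ) + 1) else 0

/-- The normalizing constant of `piLow`. -/
def lowTotal : ℝ :=
  ∑ i : Fin n, if i.val + 1 ≤ n - b then (degOrd dseq i : ℝ) else 0

theorem piLow_eq : piLow dseq b = Measure.sum fun j : ℕ =>
    ENNReal.ofReal (lowMass dseq b j / lowTotal dseq b) • Measure.dirac j := rfl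

theorem lowMass_nonneg (j : ℕ) : 0 ≤ lowMass dseq b j :=
  Finset.sum_nonneg fun i _ => by split_ifs <;> positivity

theorem lowTotal_nonneg : 0 ≤ lowTotal dseq b :=
  Finset.sum_nonneg fun i _ => by split_ifs <;> positivity

theorem sum_lowMass_le (u : Finset ℕ) : ∑ j ∈ u, lowMass dseq b j ≤ lowTotal dseq b := by
  unfold lowMass lowTotal
  rw [Finset.sum_comm]
  refine Finset.sum_le_sum fun i _ => ?_
  by_cases hi : i.val + 1 ≤ n - b
  · simp only [hi, true_and, if_true]
    rcases Nat.eq_zero_or_pos (degOrd dseq i) with h0 | hpos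
    · simp [h0]
    · obtain ⟨e, he⟩ := Nat.exists_eq_succ_of_ne_zero hpos.ne'
      have : ∀ j ∈ u, (if degOrd dseq i = j + 1 then ((j : ℝ) + 1) else 0) =
          if e = j then ((j : ℝ) + 1) else 0 := fun j _ => by
        simp [he]
      rw [Finset.sum_congr rfl this, Finset.sum_ite_eq, he]
      push_cast
      split_ifs
      · exact le_rfl
      · positivity
  · simp [hi]

theorem lowTotal_le : lowTotal dseq b ≤ ∑ i, (dseq i : ℝ) := by
  rw [← sum_degOrd_eq dseq fun r => (r : ℝ)]
  exact Finset.sum_le_sum fun i _ => by split_ifs <;> simp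

theorem mul_card_sub_le_lowMass (j : ℕ) :
    ((j : ℝ) + 1) * (((Finset.univ.filter fun i : Fin n => dseq i = j + 1).card : ℝ) - b) ≤
      lowMass dseq b j := by
  have hcard : (Finset.univ.filter fun i : Fin n => dseq i = j + 1).card =
      (Finset.univ.filter fun i : Fin n => degOrd dseq i = j + 1).card := by
    simp only [Finset.card_filter]
    exact (sum_degOrd_eq dseq fun r => if r = j + 1 then 1 else 0).symm
  have htop : (Finset.univ.filter fun i : Fin n => ¬ i.val + 1 ≤ n - b).card ≤ b := by
    calc _ ≤ (Finset.Ico (n - b) n).card := by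
          refine Finset.card_le_card_of_injOn (fun i : Fin n => i.val) (fun i hi => ?_)
            Fin.val_injective.injOn
          have hi' := (Finset.mem_filter.1 hi).2
          have := i.isLt
          simp only [Finset.coe_Ico, Set.mem_Ico]
          omega
      _ ≤ b := by rw [Nat.card_Ico]; omega
  have hsplit : (Finset.univ.filter fun i : Fin n => degOrd dseq i = j + 1).card ≤
      (Finset.univ.filter fun i : Fin n =>
        i.val + 1 ≤ n - b ∧ degOrd dseq i = j + 1).card + b := by
    refine le_trans ?_ (Nat.add_le_add_left htop _)
    refine le_trans (Finset.card_le_card fun i hi => ?_) (Finset.card_union_le _ _)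
    simp only [Finset.mem_union, Finset.mem_filter, Finset.mem_univ, true_and] at hi ⊢
    tauto
  have hmass : lowMass dseq b j = ((j : ℝ) + 1) * ((Finset.univ.filter fun i : Fin n =>
      i.val + 1 ≤ n - b ∧ degOrd dseq i = j + 1).card : ℝ) := by
    unfold lowMass
    rw [← Finset.sum_filter, Finset.sum_const, nsmul_eq_mul, mul_comm]
  rw [hmass, hcard]
  refine mul_le_mul_of_nonneg_left ?_ (by positivity)
  rw [sub_le_iff_le_add]
  exact_mod_cast hsplit

theorem sum_le_sum_mul_card_add {L : ℝ} (l : ℕ) (hL : 0 < L) (hl : L ≤ l) :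
    ∑ i, (dseq i : ℝ) ≤
      ∑ r ∈ Finset.range l, (r : ℝ) * ((Finset.univ.filter fun i : Fin n => dseq i = r).card : ℝ)
        + (∑ i, (dseq i : ℝ) ^ 2) / L := by
  have hswap : ∑ r ∈ Finset.range l,
      (r : ℝ) * ((Finset.univ.filter fun i : Fin n => dseq i = r).card : ℝ) =
      ∑ i, ∑ r ∈ Finset.range l, if dseq i = r then (r : ℝ) else 0 := by
    rw [Finset.sum_comm]
    refine Finset.sum_congr rfl fun r _ => ?_
    rw [← Finset.sum_filter, Finset.sum_const, nsmul_eq_mul, mul_comm]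
  rw [hswap, Finset.sum_div, ← Finset.sum_add_distrib]
  refine Finset.sum_le_sum fun i _ => ?_
  rw [Finset.sum_ite_eq]
  have hsq : 0 ≤ (dseq i : ℝ) ^ 2 / L := by positivity
  split_ifs with h
  · linarith
  · rw [Finset.mem_range, not_lt] at h
    have : L ≤ dseq i := hl.trans (by exact_mod_cast h)
    rw [zero_add, le_div_iff₀ hL]
    nlinarith [Nat.cast_nonneg (α := ℝ) (dseq i)]

end DegreeSequence

theorem tendsto_betaSeq_div (p : ℕ → ℝ) :
    Tendsto (fun n : ℕ => (⌊betaSeq p n⌋₊ : ℝ) / n) atTop (nhds 0) := by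
  set c := lambdaOf p / (nuOf p - 1)
  have hlog : Tendsto (fun n : ℕ => Real.log n / n) atTop (nhds 0) :=
    (Real.isLittleO_log_id_atTop.tendsto_div_nhds_zero).comp tendsto_natCast_atTop_atTop
  have hsqrt : Tendsto (fun n : ℕ => 3 * Real.sqrt (c * (Real.log n / n))) atTop (nhds 0) := by
    have := ((Real.continuous_sqrt.tendsto _).comp (hlog.const_mul c)).const_mul 3
    simpa using this
  refine squeeze_zero (fun n => by positivity) (fun n => ?_) hsqrt
  rcases Nat.eq_zero_or_pos n with rfl | hn
  · simp
  · have hn' : (0 : ℝ) < n := by exact_mod_cast hn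
    have hβ : 0 ≤ betaSeq p n := by unfold betaSeq; positivity
    rw [div_le_iff₀ hn']
    refine (Nat.floor_le hβ).trans_eq ?_
    have : c * n * Real.log n = c * (Real.log n / n) * (n : ℝ) ^ 2 := by field_simp
    unfold betaSeq
    rw [this, Real.sqrt_mul' _ (by positivity), Real.sqrt_sq hn'.le, mul_assoc]

/-- Along a degree sequence satisfying the degree condition, some truncated mean of `piLow`
eventually exceeds any given `m` with `0 ≤ m < ν`. -/
theorem exists_eventually_lt_truncated_mean {d : ∀ n : ℕ, Fin n → ℕ} {p : ℕ → ℝ} {dmin : ℕ}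
    (hcond : DegreeCondition d p dmin) {m : ℝ} (hm0 : 0 ≤ m) (hm : m < nuOf p) :
    ∃ M : ℕ, ∀ᶠ n : ℕ in atTop,
      m * lowTotal (d n) ⌊betaSeq p n⌋₊ <
        ∑ j ∈ Finset.range M, (j : ℝ) * lowMass (d n) ⌊betaSeq p n⌋₊ j := by
  obtain ⟨C, hC⟩ := hcond.sq_bound
  have hlam : 0 < lambdaOf p := hcond.lambda_pos
  have hlt : m * lambdaOf p < ∑' r : ℕ, (r : ℝ) * (((r : ℝ) + 1) * p (r + 1)) := by
    rwa [nuOf, lt_div_iff₀ hlam] at hm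
  have hsum : Summable fun r : ℕ => (r : ℝ) * (((r : ℝ) + 1) * p (r + 1)) := by
    by_contra h
    rw [tsum_eq_zero_of_not_summable h] at hlt
    exact absurd hlt (not_lt.2 (by positivity))
  obtain ⟨M, hM⟩ := (hsum.hasSum.tendsto_sum_nat.eventually_const_lt hlt).exists
  obtain ⟨l, hl, hl0⟩ : ∃ l : ℕ, m * (lambdaOf p + C / l) <
      ∑ r ∈ Finset.range M, (r : ℝ) * (((r : ℝ) + 1) * p (r + 1)) ∧ 0 < l := by
    have ht : Tendsto (fun l : ℕ => m * (lambdaOf p + C / l)) atTop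
        (nhds (m * (lambdaOf p + 0))) :=
      ((tendsto_const_div_atTop_nhds_zero_nat C).const_add _).const_mul _
    rw [add_zero] at ht
    exact ((ht.eventually_lt_const hM).and (eventually_gt_atTop 0)).exists
  have hpart : ∑ r ∈ Finset.range l, (r : ℝ) * p r ≤ lambdaOf p :=
    hcond.summable_mul.sum_le_tsum _ fun r _ => mul_nonneg r.cast_nonneg (hcond.nonneg r)
  have hlow : Tendsto (fun n : ℕ => ∑ j ∈ Finset.range M, (j : ℝ) * (((j : ℝ) + 1) *
      (((Finset.univ.filter fun i : Fin n => d n i = j + 1).card : ℝ) / n -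
        (⌊betaSeq p n⌋₊ : ℝ) / n))) atTop
      (nhds (∑ j ∈ Finset.range M, (j : ℝ) * (((j : ℝ) + 1) * (p (j + 1) - 0)))) :=
    tendsto_finsetSum _ fun j _ =>
      (((hcond.tendsto_freq (j + 1)).sub (tendsto_betaSeq_div p)).const_mul _).const_mul _
  have hup : Tendsto (fun n : ℕ => m * (∑ r ∈ Finset.range l, (r : ℝ) *
      (((Finset.univ.filter fun i : Fin n => d n i = r).card : ℝ) / n) + C / l)) atTop
      (nhds (m * (∑ r ∈ Finset.range l, (r : ℝ) * p r + C / l))) :=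
    ((tendsto_finsetSum _ fun r _ => (hcond.tendsto_freq r).const_mul _).add_const _).const_mul _
  simp only [sub_zero] at hlow
  have hlim : m * (∑ r ∈ Finset.range l, (r : ℝ) * p r + C / l) <
      ∑ r ∈ Finset.range M, (r : ℝ) * (((r : ℝ) + 1) * p (r + 1)) :=
    (mul_le_mul_of_nonneg_left (by linarith) hm0).trans_lt hl
  refine ⟨M, ?_⟩
  filter_upwards [hup.eventually_lt hlow hlim, eventually_gt_atTop 0] with n hn hn0
  have hn' : (0 : ℝ) < n := by exact_mod_cast hn0
  have hl' : (0 : ℝ) < l := by exact_mod_cast hl0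
  have hT : lowTotal (d n) ⌊betaSeq p n⌋₊ ≤ (∑ r ∈ Finset.range l, (r : ℝ) *
      (((Finset.univ.filter fun i : Fin n => d n i = r).card : ℝ) / n) + C / l) * n := by
    refine ((lowTotal_le _ _).trans (sum_le_sum_mul_card_add (d n) l hl' le_rfl)).trans ?_
    rw [add_mul, Finset.sum_mul]
    refine add_le_add (Finset.sum_le_sum fun r _ => ?_) ?_
    · rw [mul_assoc, div_mul_cancel₀ _ hn'.ne']
    · rw [div_mul_eq_mul_div]
      exact div_le_div_of_nonneg_right (hC n) hl'.le
  have hA : (∑ j ∈ Finset.range M, (j : ℝ) * (((j : ℝ) + 1) *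
      (((Finset.univ.filter fun i : Fin n => d n i = j + 1).card : ℝ) / n -
        (⌊betaSeq p n⌋₊ : ℝ) / n))) * n ≤
      ∑ j ∈ Finset.range M, (j : ℝ) * lowMass (d n) ⌊betaSeq p n⌋₊ j := by
    rw [Finset.sum_mul]
    refine Finset.sum_le_sum fun j _ => ?_
    rw [mul_assoc, mul_assoc, sub_mul, div_mul_cancel₀ _ hn'.ne', div_mul_cancel₀ _ hn'.ne']
    exact mul_le_mul_of_nonneg_left (mul_card_sub_le_lowMass _ _ j) j.cast_nonneg
  calc _ ≤ m * ((∑ r ∈ Finset.range l, (r : ℝ) *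
      (((Finset.univ.filter fun i : Fin n => d n i = r).card : ℝ) / n) + C / l) * n) :=
        mul_le_mul_of_nonneg_left hT hm0
    _ < _ := by
        rw [← mul_assoc]
        exact (mul_lt_mul_of_pos_right hn hn').trans_le hA

/-- Lemma 8/`lem-upp` of the paper: if `D̲_i^{(n)}` are i.i.d. with
distribution `π̲^{(n)}`, then for any `η < ν` there is `γ > 0` such that for all `n` large
enough and all `k ≥ 1`, `P(D̲_1 + ⋯ + D̲_k ≤ kη) ≤ e^{−γk}`. -/
theorem size_biased_lower_large_deviation
    (d : ∀ n : ℕ, Fin n → ℕ) (p : ℕ → ℝ) (dmin : ℕ)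
    (hcond : DegreeCondition d p dmin) (η : ℝ) (hη : η < nuOf p) :
    ∃ γ : ℝ, 0 < γ ∧ ∃ N : ℕ, ∀ n : ℕ, N ≤ n → ∀ k : ℕ, 1 ≤ k →
      (Measure.map (fun f : Fin k → ℕ => ∑ i, f i)
          (Measure.pi fun _ : Fin k => piLow (d n) ⌊betaSeq p n⌋₊))
        {s : ℕ | (s : ℝ) ≤ k * η} ≤ ENNReal.ofReal (Real.exp (-γ * k)) := by
  rcases lt_or_ge η 0 with hneg | hη0
  · refine ⟨1, one_pos, 0, fun n _ k hk => ?_⟩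
    have hempty : {s : ℕ | (s : ℝ) ≤ k * η} = ∅ := by
      ext s
      have hk' : (0 : ℝ) < k := by exact_mod_cast hk
      have hneg' := mul_neg_of_pos_of_neg hk' hneg
      have hs := s.cast_nonneg (α := ℝ)
      simp only [Set.mem_ofPred_eq, Set.mem_empty_iff_false, iff_false, not_le]
      linarith
    rw [hempty, measure_empty]
    exact zero_le
  · obtain ⟨m, hηm, hmν⟩ := exists_between hη
    obtain ⟨M, hM⟩ := exists_eventually_lt_truncated_mean hcond (hη0.trans hηm.le) hmν
    obtain ⟨N, hN⟩ := eventually_atTop.1 hM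
    refine ⟨(m - η) ^ 2 / (4 * ((M : ℝ) ^ 2 + 1)),
      div_pos (pow_pos (by linarith) 2) (by positivity), N, fun n hn k _ => ?_⟩
    have hmean := hN n hn
    set b := ⌊betaSeq p n⌋₊
    have hT0 := lowTotal_nonneg (d n) b
    have hTpos : 0 < lowTotal (d n) b := by
      refine hT0.lt_of_ne' fun h0 => ?_
      have hzero : ∀ j, lowMass (d n) b j = 0 := fun j => by
        have := sum_lowMass_le (d n) b {j}
        rw [Finset.sum_singleton, h0] at this
        exact le_antisymm this (lowMass_nonneg _ _ _)
      simp [h0, hzero] at hmean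
    have hw : ∀ j, 0 ≤ lowMass (d n) b j / lowTotal (d n) b := fun j =>
      div_nonneg (lowMass_nonneg _ _ _) hT0
    have hle : ∀ u : Finset ℕ, ∑ j ∈ u, lowMass (d n) b j / lowTotal (d n) b ≤ 1 := fun u => by
      rw [← Finset.sum_div]
      exact div_le_one_of_le₀ (sum_lowMass_le _ _ _) hT0
    rw [piLow_eq]
    refine pi_sum_le_le_exp_of_truncated_mean hw (summable_of_sum_le hw hle)
      (Real.tsum_le_of_sum_le hw hle) ?_ hηm k
    simp only [← mul_div_assoc]
    rw [← Finset.sum_div, le_div_iff₀ hTpos]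
    exact hmean.le

end Flooding
end
end
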